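/- Fix σ ∈ Σ and write n := d σ and S_σ for the finite set of ex-post states s : Fin n → S_o with joint probability P(s|σ) := ∏_i p σ (s i). For a choice map α : S_σ → Fin n define the ex-ante reward R(σ,α) := ∑_{s ∈ S_σ} P(s|σ) · ( v((s (α s)).2) − c(α s) ) and, for σ' ∈ Σ, the transition probability P(σ'|σ,α) := ∑_{s ∈ S_σ} P(s|σ) · 1{(s (α s)).1 = σ'}. Then for every W : Σ → ℝ, the maximum over all choice maps α : S_σ → Fin n of [ R(σ,α) + γ · ∑_{σ' ∈ Σ} P(σ'|σ,α) · W σ' ] equals (T_γ W)(σ) = ∑_{s ∈ S_σ} P(s|σ) · max_{a : Fin n} [ v((s a).2) − c(a) + γ · W((s a).1) ]. -/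

import Mathlib

open Finset

/-- The ex-ante Bellman operator of a pMDP:
`(T_γ W)(σ) = ∑_{s : Fin (d σ) → Σ × R} (∏ i, p σ (s i)) ·
  max_{a} [ v (s a).2 − c a + γ · W (s a).1 ]`. -/
noncomputable def exAnteBellman {Sg R : Type*} [Fintype Sg] [Fintype R]
    (v : R → ℝ) (p : Sg → Sg × R → ℝ) (d : Sg → ℕ) (hd : ∀ σ, 1 ≤ d σ)
    (c : ℕ → ℝ) (γ : ℝ) (W : Sg → ℝ) (σ : Sg) : ℝ :=
  ∑ s : Fin (d σ) → Sg × R, (∏ i, p σ (s i)) *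
    (Finset.univ.sup' ⟨⟨0, hd σ⟩, Finset.mem_univ _⟩
      fun a : Fin (d σ) => v (s a).2 - c a.val + γ * W (s a).1)

/-- Under weights `w`, an expected reward plus a discounted average of `W` against the pushforward of
`w` along `f` is a single weighted sum. -/
theorem sum_mul_add_mul_sum_pushforward {ι κ : Type*} [Fintype ι] [Fintype κ] [DecidableEq κ]
    (w r : ι → ℝ) (f : ι → κ) (γ : ℝ) (W : κ → ℝ) :
    ∑ s, w s * r s + γ * ∑ k, (∑ s, w s * (if f s = k then (1 : ℝ) else 0)) * W k
      = ∑ s, w s * (r s + γ * W (f s)) := by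
  have h : ∑ k, (∑ s, w s * (if f s = k then (1 : ℝ) else 0)) * W k = ∑ s, w s * W (f s) := by
    simp_rw [Finset.sum_mul]
    rw [Finset.sum_comm]
    simp
  rw [h, Finset.mul_sum, ← Finset.sum_add_distrib]
  exact Finset.sum_congr rfl fun s _ => by ring

/-- The ex-ante MDP reduction of a pMDP satisfies the Bellman equation of the
ex-post reduction: for fixed `σ`, the maximum over all choice maps
`α : (Fin (d σ) → Σ × R) → Fin (d σ)` of
`R(σ,α) + γ · ∑ σ', P(σ'|σ,α) · W σ'` equals `(T_γ W)(σ)`. -/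
theorem exAnte_bellman_eq_max_over_choice_maps
    {Sg R : Type*} [Fintype Sg] [Fintype R] [Nonempty Sg] [Nonempty R]
    [DecidableEq Sg]
    (v : R → ℝ) (p : Sg → Sg × R → ℝ)
    (hp0 : ∀ σ x, 0 ≤ p σ x) (hp1 : ∀ σ, ∑ x : Sg × R, p σ x = 1)
    (d : Sg → ℕ) (hd : ∀ σ, 1 ≤ d σ) (c : ℕ → ℝ)
    (γ : ℝ) (hγ : 0 ≤ γ) (σ : Sg) (W : Sg → ℝ) :
    IsGreatest
      {x : ℝ | ∃ α : (Fin (d σ) → Sg × R) → Fin (d σ),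
        x = (∑ s : Fin (d σ) → Sg × R, (∏ i, p σ (s i)) *
              (v (s (α s)).2 - c (α s).val))
          + γ * ∑ σ' : Sg,
              (∑ s : Fin (d σ) → Sg × R, (∏ i, p σ (s i)) *
                (if (s (α s)).1 = σ' then (1 : ℝ) else 0)) * W σ'}
      (exAnteBellman v p d hd c γ W σ) := by
  have key (α : (Fin (d σ) → Sg × R) → Fin (d σ)) :=
    sum_mul_add_mul_sum_pushforward (fun s : Fin (d σ) → Sg × R => ∏ i, p σ (s i))
      (fun s => v (s (α s)).2 - c (α s).val) (fun s => (s (α s)).1) γ W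
  constructor
  · have hmax (s : Fin (d σ) → Sg × R) := Finset.exists_mem_eq_sup' (s := Finset.univ)
      ⟨⟨0, hd σ⟩, Finset.mem_univ _⟩
      fun a : Fin (d σ) => v (s a).2 - c a.val + γ * W (s a).1
    choose α _ hα using hmax
    refine ⟨α, Eq.trans ?_ (key α).symm⟩
    exact Finset.sum_congr rfl fun s _ => congrArg _ (hα s)
  · rintro x ⟨α, rfl⟩
    refine (key α).trans_le (Finset.sum_le_sum fun s _ => ?_)
    exact mul_le_mul_of_nonneg_left
      (Finset.le_sup' (fun a : Fin (d σ) => v (s a).2 - c a.val + γ * W (s a).1)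
        (Finset.mem_univ (α s)))
      (Finset.prod_nonneg fun i _ => hp0 σ (s i))
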